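/- arXiv:2102.11422 — 3 statements merged into one kernel-verified Lean document; each statement's English description precedes it below -/
import Mathlib

section
/- Every simple, cosimple, binary (2,2)-uniform matroid has rank at most 11. -/
open Set

namespace Matroid

variable {α β : Type*}

/-- The rank of a set `X` in a matroid `M` : the maximum cardinality of an
independent subset of `X`. -/
noncomputable def rSet (M : Matroid α) (X : Set α) : ℕ :=
  sSup {n : ℕ | ∃ I, M.Indep I ∧ I ⊆ X ∧ I.ncard = n}

/-- The rank of a matroid. -/
noncomputable def rankM (M : Matroid α) : ℕ := M.rSet M.E

/-- A circuit of `M` : a minimal dependent subset of the ground set. -/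
def CircuitM (M : Matroid α) (C : Set α) : Prop :=
  C ⊆ M.E ∧ ¬ M.Indep C ∧ ∀ D, D ⊂ C → M.Indep D

/-- Deletion of a set from a matroid. -/
def deleteS (M : Matroid α) (D : Set α) : Matroid α := M ↾ (M.E \ D)

/-- Contraction of a set in a matroid. -/
def contractS (M : Matroid α) (C : Set α) : Matroid α := (M✶.deleteS C)✶

/-- `N` is a minor of `M` if it is obtained from `M` by a contraction
followed by a deletion. -/
def IsMinorOf (N M : Matroid α) : Prop :=
  ∃ C D : Set α, C ⊆ M.E ∧ D ⊆ M.E ∧ Disjoint C D ∧ N = (M.contractS C).deleteS D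

/-- `M` is isomorphic to `N` : there is a bijection of the ground sets
preserving independence. -/
def IsoTo (M : Matroid α) (N : Matroid β) : Prop :=
  ∃ e : M.E ≃ N.E, ∀ I : Set M.E,
    M.Indep ((↑) '' I) ↔ N.Indep ((↑) '' (e '' I))

/-- The matroid `U_{k,k} ⊕ U_{0,ℓ}` consisting of `k` coloops and `ℓ` loops. -/
def freeLoopy (k ℓ : ℕ) : Matroid (Fin (k + ℓ)) :=
  uniqueBaseOn {i : Fin (k + ℓ) | (i : ℕ) < k} univ

/-- A matroid is `(k,ℓ)`-uniform if it has no minor isomorphic to `U_{k,k} ⊕ U_{0,ℓ}`. -/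
def KLUniform (k ℓ : ℕ) (M : Matroid α) : Prop :=
  ¬ ∃ N : Matroid α, N.IsMinorOf M ∧ N.IsoTo (freeLoopy k ℓ)

/-- A matroid is paving if every circuit has size at least the rank of the matroid. -/
def PavingM (M : Matroid α) : Prop := ∀ C, M.CircuitM C → M.rankM ≤ C.ncard

/-- A matroid is simple if it has no circuits of size at most two. -/
def SimpleM (M : Matroid α) : Prop := ∀ C, M.CircuitM C → 2 < C.ncard

/-- A matroid is uniform if its independent sets are exactly the subsets of the
ground set of cardinality at most the rank. -/
def UniformM (M : Matroid α) : Prop := ∀ I ⊆ M.E, (M.Indep I ↔ I.ncard ≤ M.rankM)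

/-- A matroid is representable over a field `𝔽` if there is a map from its ground type to
an `𝔽`-vector space under which independence coincides with linear independence. -/
def RepOver (𝔽 : Type*) [Field 𝔽] (M : Matroid α) : Prop :=
  ∃ (W : Type) (_ : AddCommGroup W) (_ : Module 𝔽 W) (φ : α → W),
    ∀ I ⊆ M.E, (M.Indep I ↔ Set.InjOn φ I ∧ LinearIndependent 𝔽 (fun x : I => φ x))


theorem exists_coord_aux [DecidableEq α] {W : Type*} [AddCommGroup W] [Module (ZMod 2) W] (φ : α → W)
    (B : Finset α) (hB : LinearIndepOn (ZMod 2) φ (B : Set α)) :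
    ∃ c : α → W →ₗ[ZMod 2] ZMod 2,
      (∀ b ∈ B, ∀ b' ∈ B, c b (φ b') = if b' = b then 1 else 0) ∧
      ∀ w ∈ Submodule.span (ZMod 2) (φ '' (B : Set α)), w = ∑ b ∈ B, c b w • φ b := by
  obtain ⟨L, hL⟩ := LinearMap.exists_leftInverse_of_injective _
    (LinearMap.ker_eq_bot.2 (show Function.Injective
      (Finsupp.linearCombination (ZMod 2) (fun x : (B : Set α) => φ x)) from hB))
  have hL1 : ∀ b : (B : Set α), L (φ b) = Finsupp.single b 1 := by
    intro b
    have := LinearMap.congr_fun hL (Finsupp.single b 1)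
    simpa using this
  have key : ∀ b ∈ B, ∀ b' ∈ B, (if h : b ∈ B then (Finsupp.lapply (⟨b, h⟩ : (B : Set α))).comp L
      else 0 : W →ₗ[ZMod 2] ZMod 2) (φ b') = if b' = b then 1 else 0 := by
    intro b hb b' hb'
    rw [dif_pos hb]
    simp [hL1 ⟨b', hb'⟩, Finsupp.single_apply]
  refine ⟨fun b => if h : b ∈ B then (Finsupp.lapply (⟨b, h⟩ : (B : Set α))).comp L else 0,
    key, ?_⟩
  intro w hw
  induction hw using Submodule.span_induction with
  | mem x hx =>
    obtain ⟨b', hb', rfl⟩ := hx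
    have hb' : b' ∈ B := hb'
    rw [Finset.sum_congr rfl (fun b hb => by rw [key b hb b' hb'])]
    simp [hb']
  | zero => simp
  | add x y _ _ hx hy =>
    simp only [map_add, add_smul, Finset.sum_add_distrib]
    rw [← hx, ← hy]
  | smul a x _ hx =>
    simp only [map_smul, smul_assoc, ← Finset.smul_sum]
    rw [← hx]

theorem decide_aux : ∀ u : Fin 3 → ZMod 2, u ≠ 0 → ∃ (w1 w2 : Fin 3 → ZMod 2) (i j : Fin 3),
    i ≠ j ∧ w1 i = 1 ∧ w1 j = 0 ∧ w2 i = 0 ∧ w2 j = 1 ∧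
    ∑ k, w1 k * u k = 0 ∧ ∑ k, w2 k * u k = 0 := by
  intro u hu
  have h01 : ∀ a : ZMod 2, a = 0 ∨ a = 1 := by decide
  rcases h01 (u 0) with h0 | h0
  · rcases h01 (u 1) with h1 | h1
    · rcases h01 (u 2) with h2 | h2
      · exact absurd (by ext k; fin_cases k <;> simp [h0, h1, h2]) hu
      · exact ⟨![1, 0, u 0], ![0, 1, u 1], 0, 1, by
          simp [Fin.sum_univ_three, h2, CharTwo.add_self_eq_zero]⟩
    · exact ⟨![1, u 0, 0], ![0, u 2, 1], 0, 2, by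
        simp [Fin.sum_univ_three, h1, CharTwo.add_self_eq_zero]⟩
  · exact ⟨![u 1, 1, 0], ![u 2, 0, 1], 1, 2, by
      simp [Fin.sum_univ_three, h0, CharTwo.add_self_eq_zero]⟩

theorem minor_aux (M : Matroid α) (B C : Set α) (hB : M.IsBase B) (hCB : C ⊆ B) (f1 f2 b1 b2 : α)
    (hf : f1 ≠ f2) (hb : b1 ≠ b2) (hb1 : b1 ∈ B) (hb2 : b2 ∈ B) (hb1C : b1 ∉ C) (hb2C : b2 ∉ C)
    (hf1 : f1 ∈ M.closure C) (hf2 : f2 ∈ M.closure C) (hf1C : f1 ∉ C) (hf2C : f2 ∉ C) :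
    ¬ M.KLUniform 2 2 := by
  classical
  have hBE := hB.subset_ground
  have hnB : ∀ f, f ∈ M.closure C → f ∉ C → f ∉ B := by
    intro f hf hfC hfB
    have h1 : M.Indep (insert f C) := hB.indep.subset (insert_subset hfB hCB)
    exact (((hB.indep.subset hCB).insert_indep_iff_of_notMem hfC).1 h1).2 hf
  have hf1B := hnB f1 hf1 hf1C
  have hf2B := hnB f2 hf2 hf2C
  have hf1E : f1 ∈ M.E := M.closure_subset_ground C hf1
  have hf2E : f2 ∈ M.E := M.closure_subset_ground C hf2
  set P := B \ {b1, b2} with hP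
  have hPi : M.Indep P := hB.indep.subset sdiff_subset
  have hCP : C ⊆ P := by
    intro x hx
    refine ⟨hCB hx, ?_⟩
    rintro (rfl | rfl)
    · exact hb1C hx
    · exact hb2C hx
  set Q : Set α := {b1, b2, f1, f2} with hQ
  have hPQ : Disjoint Q P := by
    rw [Set.disjoint_left]
    rintro x (rfl | rfl | rfl | rfl) hx
    · exact hx.2 (by simp)
    · exact hx.2 (by simp)
    · exact hf1B hx.1
    · exact hf2B hx.1
  have hQE : Q ⊆ M.E := by
    rintro x (rfl | rfl | rfl | rfl)
    exacts [hBE hb1, hBE hb2, hf1E, hf2E]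
  set N := (M.contractS P).deleteS ((M.E \ P) \ Q) with hN
  have hNE : N.E = Q := by
    change (M.E \ P) \ ((M.E \ P) \ Q) = Q
    ext x
    simp only [mem_sdiff, not_and, not_not]
    constructor
    · rintro ⟨h1, h2⟩; exact h2 h1
    · intro h
      exact ⟨⟨hQE h, Set.disjoint_left.1 hPQ h⟩, fun _ => h⟩
  have hNI : ∀ I ⊆ Q, (N.Indep I ↔ f1 ∉ I ∧ f2 ∉ I) := by
    intro I hI
    have h0 : N.Indep I ↔ (M ／ P).Indep I := by
      change (M.contractS P ↾ _).Indep I ↔ _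
      rw [Matroid.restrict_indep_iff]
      refine ⟨fun h => h.1, fun h => ⟨h, ?_⟩⟩
      have := hNE
      rw [← this] at hI
      exact hI
    rw [h0, hPi.contract_indep_iff]
    constructor
    · rintro ⟨_, h2⟩
      have hno : ∀ f, f ∈ M.closure C → f ∉ B → f ∉ I := by
        intro f hf hfB hfI
        have h3 : M.Indep (insert f P) := h2.subset
          (insert_subset (Or.inl hfI) subset_union_right)
        exact ((hPi.insert_indep_iff_of_notMem (fun h => hfB h.1)).1 h3).2
          (M.closure_subset_closure hCP hf)
      exact ⟨hno f1 hf1 hf1B, hno f2 hf2 hf2B⟩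
    · rintro ⟨h1, h2⟩
      refine ⟨hPQ.mono_left hI, hB.indep.subset ?_⟩
      refine union_subset ?_ sdiff_subset
      intro x hx
      rcases hI hx with (rfl | rfl | rfl | rfl)
      exacts [hb1, hb2, absurd hx h1, absurd hx h2]
  intro hu
  apply hu
  refine ⟨N, ⟨P, (M.E \ P) \ Q, sdiff_subset.trans hBE, sdiff_subset.trans sdiff_subset, ?_, rfl⟩, ?_⟩
  · rw [Set.disjoint_left]
    intro x hx hx'
    exact hx'.1.2 hx
  have h11 : b1 ≠ f1 := by rintro rfl; exact hf1B hb1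
  have h12 : b1 ≠ f2 := by rintro rfl; exact hf2B hb1
  have h21 : b2 ≠ f1 := by rintro rfl; exact hf1B hb2
  have h22 : b2 ≠ f2 := by rintro rfl; exact hf2B hb2
  let g : Fin (2+2) → α := ![b1, b2, f1, f2]
  have hgQ : ∀ i, g i ∈ N.E := by
    intro i
    rw [hNE]
    fin_cases i <;> simp [g, hQ]
  let e0 : (freeLoopy 2 2).E → N.E := fun i => ⟨g i.1, hgQ _⟩
  have he0 : Function.Bijective e0 := by
    constructor
    · rintro ⟨i, hi⟩ ⟨j, hj⟩ hij
      have hij : g i = g j := congrArg Subtype.val hij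
      apply Subtype.ext
      change i = j
      revert hij
      fin_cases i <;> fin_cases j <;> simp [g, hb, hf, h11, h12, h21, h22, hb.symm, hf.symm, h11.symm, h12.symm, h21.symm, h22.symm]
    · rintro ⟨x, hx⟩
      have hx' := hx
      rw [hNE] at hx'
      have : ∃ i, g i = x := by
        rcases hx' with (rfl | rfl | rfl | rfl)
        exacts [⟨0, rfl⟩, ⟨1, rfl⟩, ⟨2, rfl⟩, ⟨3, rfl⟩]
      obtain ⟨i, hi⟩ := this
      exact ⟨⟨i, by simp [freeLoopy]⟩, Subtype.ext hi⟩
  let e := (Equiv.ofBijective e0 he0).symm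
  refine ⟨e, ?_⟩
  intro I
  have hI : ((↑) '' I : Set α) ⊆ Q := by
    rintro _ ⟨x, _, rfl⟩
    rw [← hNE]; exact x.2
  rw [hNI _ hI]
  have hmem : ∀ i : Fin (2+2), i ∈ ((↑) '' (e '' I) : Set (Fin (2+2))) ↔ g i ∈ ((↑) '' I : Set α) := by
    intro i
    have hiE : i ∈ (freeLoopy 2 2).E := by simp [freeLoopy]
    constructor
    · rintro ⟨_, ⟨x, hx, rfl⟩, h⟩
      refine ⟨x, hx, ?_⟩
      have h2 : e0 (e x) = x := (Equiv.ofBijective e0 he0).apply_symm_apply x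
      rw [← h, ← h2]
      simp [e0, h2]
    · rintro ⟨x, hx, h⟩
      have h2 : x = e0 ⟨i, hiE⟩ := Subtype.ext h
      refine ⟨e x, ⟨x, hx, rfl⟩, ?_⟩
      have : e x = ⟨i, hiE⟩ := by
        rw [h2]; exact (Equiv.ofBijective e0 he0).symm_apply_apply _
      rw [this]
  rw [show f1 = g 2 from rfl, show f2 = g 3 from rfl, ← hmem, ← hmem]
  simp only [freeLoopy, uniqueBaseOn_indep_iff']
  generalize ((↑) '' (e '' I) : Set (Fin (2+2))) = J
  constructor
  · rintro ⟨h2, h3⟩ i hi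
    refine ⟨?_, trivial⟩
    fin_cases i
    · simp
    · simp
    · exact absurd hi h2
    · exact absurd hi h3
  · intro h
    constructor
    · intro h2; have := (h h2).1; simp at this
    · intro h2; have := (h h2).1; simp at this

/-- a simple cosimple binary `(2,2)`-uniform matroid has rank at most `11`. -/
theorem stmt15 {α : Type*} (M : Matroid α) (hfin : M.Finite)
    (hs : M.SimpleM) (hcs : M✶.SimpleM) (hbin : Matroid.RepOver (ZMod 2) M)
    (hu : M.KLUniform 2 2) : M.rankM ≤ 11 := by
  classical
  obtain ⟨W, _, _, φ, hφ⟩ := hbin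
  have hind : ∀ I ⊆ M.E, (M.Indep I ↔ LinearIndepOn (ZMod 2) φ I) := by
    intro I hI
    rw [hφ I hI]
    exact ⟨fun h => h.2, fun h => ⟨LinearIndepOn.injOn h, h⟩⟩
  have hEfin := M.ground_finite
  obtain ⟨B0, hB0⟩ := M.exists_isBase
  obtain ⟨B, rfl⟩ := (hEfin.subset hB0.subset_ground).exists_finset_coe
  have hBE := hB0.subset_ground
  have hcard : ∀ I, M.Indep I → I.ncard ≤ B.card := by
    intro I hI
    obtain ⟨B', hB', hIB⟩ := hI.exists_isBase_superset
    rw [← Set.ncard_coe_finset B, ← hB'.ncard_eq_ncard_of_isBase hB0]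
    exact Set.ncard_le_ncard hIB (hEfin.subset hB'.subset_ground)
  have hrank : M.rankM ≤ B.card := by
    apply csSup_le'
    rintro n ⟨I, hI, _, rfl⟩
    exact hcard I hI
  by_contra hr
  have hr12 : 12 ≤ B.card := by omega
  -- closure and span
  have hspan : ∀ I, M.Indep I → ∀ x ∈ M.E, x ∈ M.closure I →
      φ x ∈ Submodule.span (ZMod 2) (φ '' I) := by
    intro I hI x hx hxI
    by_cases hxI' : x ∈ I
    · exact Submodule.subset_span ⟨x, hxI', rfl⟩
    by_contra hcon
    have h1 := (linearIndepOn_insert hxI').2 ⟨(hind I hI.subset_ground).1 hI, hcon⟩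
    have h2 := (hind _ (insert_subset hx hI.subset_ground)).2 h1
    exact ((hI.insert_indep_iff_of_notMem hxI').1 h2).2 hxI
  have hclos : ∀ I, M.Indep I → ∀ x ∈ M.E,
      φ x ∈ Submodule.span (ZMod 2) (φ '' I) → x ∉ I → x ∈ M.closure I := by
    intro I hI x hx hxs hxI
    by_contra hcon
    have h1 := (hI.insert_indep_iff_of_notMem hxI).2 ⟨hx, hcon⟩
    have h2 := (hind _ (insert_subset hx hI.subset_ground)).1 h1
    exact ((linearIndepOn_insert hxI).1 h2).2 hxs
  obtain ⟨c, hc, hcs'⟩ := exists_coord_aux φ B ((hind _ hBE).1 hB0.indep)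
  have hexp : ∀ x ∈ M.E, φ x = ∑ b ∈ B, c b (φ x) • φ b := by
    intro x hx
    exact hcs' _ (hspan _ hB0.indep x hx (by rw [hB0.closure_eq]; exact hx))
  -- at least three elements outside `B`
  obtain ⟨S, hS⟩ := (hEfin.subset (sdiff_subset : M.E \ (B : Set α) ⊆ M.E)).exists_finset_coe
  have hS3 : 3 ≤ S.card := by
    by_contra hlt
    have hpig : ∃ b ∈ B, ∃ b' ∈ B, b ≠ b' ∧
        (fun e : S => c b (φ e)) = (fun e : S => c b' (φ e)) := by
      apply Finset.exists_ne_map_eq_of_card_lt_of_maps_to (t := (Finset.univ : Finset (S → ZMod 2)))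
      · rw [Finset.card_univ, Fintype.card_fun, ZMod.card, Fintype.card_coe]
        have : 2 ^ S.card ≤ 2 ^ 2 := Nat.pow_le_pow_right (by norm_num) (by omega)
        omega
      · intro x _; simp
    obtain ⟨b, hb, b', hb', hne, hbb⟩ := hpig
    have hpairE : ({b, b'} : Set α) ⊆ M✶.E := by
      rintro x (rfl | rfl)
      exacts [hBE hb, hBE hb']
    have hpair : M✶.Indep {b, b'} := by
      by_contra hdep
      have hdep : M✶.Dep {b, b'} := ⟨hdep, hpairE⟩
      obtain ⟨C, hC, hCC⟩ := hdep.exists_isCircuit_subset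
      have h2 := hcs C ⟨hCC.subset_ground, hCC.dep.not_indep, fun D hD => hCC.ssubset_indep hD⟩
      have h3 := Set.ncard_le_ncard hC (Set.toFinite _)
      rw [Set.ncard_pair hne] at h3
      omega
    obtain ⟨_, B', hB', hdisj⟩ := dual_indep_iff_exists'.1 hpair
    have h1 := hspan B' hB'.indep b (hBE hb) (by rw [hB'.closure_eq]; exact hBE hb)
    have h2 : φ '' B' ⊆ LinearMap.ker (c b + c b') := by
      rintro _ ⟨x, hx, rfl⟩
      have hxb : x ≠ b := by rintro rfl; exact Set.disjoint_left.1 hdisj (by simp) hx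
      have hxb' : x ≠ b' := by rintro rfl; exact Set.disjoint_left.1 hdisj (by simp) hx
      simp only [SetLike.mem_coe, LinearMap.mem_ker, LinearMap.add_apply]
      by_cases hxB : x ∈ B
      · rw [hc b hb x hxB, hc b' hb' x hxB]; simp [hxb, hxb']
      · have hxS : x ∈ S := by
          rw [← Finset.mem_coe, hS]; exact ⟨hB'.subset_ground hx, hxB⟩
        have := congrFun hbb ⟨x, hxS⟩
        simp only at this
        rw [this]
        exact CharTwo.add_self_eq_zero _
    have h3 := Submodule.span_le.2 h2 h1
    rw [LinearMap.mem_ker, LinearMap.add_apply, hc b hb b hb, hc b' hb' b hb] at h3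
    simp [hne] at h3
  obtain ⟨S', hS'S, hS'⟩ := Finset.exists_subset_card_eq hS3
  let e' : Fin 3 ≃ S' := (S'.equivFinOfCardEq hS').symm
  let e : Fin 3 → α := fun i => e' i
  have he : Function.Injective e := Subtype.val_injective.comp e'.injective
  have heS : ∀ i, e i ∈ M.E ∧ e i ∉ B := by
    intro i
    have : e i ∈ (S : Set α) := hS'S (e' i).2
    rw [hS] at this
    exact this
  let v : α → Fin 3 → ZMod 2 := fun x i => if x ∈ B then c x (φ (e i)) else if x = e i then 1 else 0
  let R : Finset α := Finset.univ.image e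
  have hRc : R.card = 3 := by simp [R, Finset.card_image_of_injective _ he]
  have hdBR : Disjoint B R := by
    rw [Finset.disjoint_left]
    intro x hx hxR
    obtain ⟨i, _, rfl⟩ := Finset.mem_image.1 hxR
    exact (heS i).2 hx
  have hve : ∀ i j, v (e i) j = if i = j then 1 else 0 := by
    intro i j
    simp [v, (heS i).2, he.eq_iff]
  let X := B ∪ R
  have hXc : X.card = B.card + 3 := by
    rw [Finset.card_union_of_disjoint hdBR, hRc]
  have hXE : (X : Set α) ⊆ M.E := by
    intro x hx
    rcases Finset.mem_union.1 hx with h | h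
    · exact hBE h
    · obtain ⟨i, _, rfl⟩ := Finset.mem_image.1 h
      exact (heS i).1
  have hzero : ∀ i, ∑ x ∈ X, v x i • φ x = 0 := by
    intro i
    rw [Finset.sum_union hdBR, Finset.sum_image (fun a _ b _ h => he h)]
    have h1 : ∑ x ∈ B, v x i • φ x = φ (e i) := by
      rw [hexp _ (heS i).1]
      apply Finset.sum_congr rfl
      intro x hx
      simp [v, hx]
    rw [h1]
    simp only [hve]
    simp only [ite_smul, one_smul, zero_smul, Finset.sum_ite_eq', Finset.mem_univ, if_true]
    rw [← two_smul (ZMod 2) (φ (e i)), show (2 : ZMod 2) = 0 from rfl, zero_smul]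
  have hzero2 : ∀ w : Fin 3 → ZMod 2, ∑ x ∈ X, (∑ i, w i * v x i) • φ x = 0 := by
    intro w
    simp only [Finset.sum_smul, mul_smul]
    rw [Finset.sum_comm]
    simp only [← Finset.smul_sum, hzero, smul_zero, Finset.sum_const_zero]
  -- pigeonhole
  have hpig : ∃ u : Fin 3 → ZMod 2, u ≠ 0 ∧ ∃ T ⊆ X, T.card = 3 ∧ ∀ x ∈ T, v x = u ∨ v x = 0 := by
    have := Finset.exists_lt_card_fiber_of_mul_lt_card_of_maps_to (s := X) (n := 2)
      (t := (Finset.univ : Finset (Fin 3 → ZMod 2)).erase 0)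
      (f := fun x => if v x = 0 then 1 else v x) (by
        intro x _
        simp only [Finset.mem_erase, Finset.mem_univ, and_true]
        split_ifs with h
        · exact one_ne_zero
        · exact h) (by
        have : ((Finset.univ : Finset (Fin 3 → ZMod 2)).erase 0).card = 7 := by
          rw [Finset.card_erase_of_mem (Finset.mem_univ _), Finset.card_univ]
          simp
        rw [this, hXc]; omega)
    obtain ⟨u, hu, hcu⟩ := this
    obtain ⟨T, hT, hT3⟩ := Finset.exists_subset_card_eq (Nat.succ_le_of_lt hcu)
    refine ⟨u, (Finset.mem_erase.1 hu).1, T, hT.trans (Finset.filter_subset _ _), hT3, ?_⟩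
    intro x hx
    have h := (Finset.mem_filter.1 (hT hx)).2
    by_cases h0 : v x = 0
    · exact Or.inr h0
    · rw [if_neg h0] at h; exact Or.inl h
  obtain ⟨u, hu0, T, hTX, hT3, hTv⟩ := hpig
  obtain ⟨w1, w2, i, j, hij, h1i, h1j, h2i, h2j, ho1, ho2⟩ := decide_aux u hu0
  have hvan : ∀ w : Fin 3 → ZMod 2, ∑ k, w k * u k = 0 → ∀ x ∈ T, ∑ k, w k * v x k = 0 := by
    intro w hw x hx
    rcases hTv x hx with h | h
    · rw [h]; exact hw
    · rw [h]; simp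
  have hwe : ∀ (w : Fin 3 → ZMod 2) k, ∑ l, w l * v (e k) l = w k := by
    intro w k
    simp [hve]
  have heX : ∀ k, e k ∈ X := fun k =>
    Finset.mem_union_right _ (Finset.mem_image_of_mem _ (Finset.mem_univ _))
  have hnT : ∀ (w : Fin 3 → ZMod 2) k, ∑ k, w k * u k = 0 → w k = 1 → e k ∉ T := by
    intro w k hw hk hT
    have := hvan w hw _ hT
    rw [hwe, hk] at this
    exact one_ne_zero this
  have hiT := hnT w1 i ho1 h1i
  have hjT := hnT w2 j ho2 h2j
  let Z := ((X \ T).erase (e i)).erase (e j)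
  have heij : e i ≠ e j := fun h => hij (he h)
  have hZc : Z.card + 2 = B.card := by
    have h1 : (X \ T).card = B.card := by
      rw [Finset.card_sdiff_of_subset hTX]; omega
    have h2 : ((X \ T).erase (e i)).card = B.card - 1 := by
      rw [Finset.card_erase_of_mem (Finset.mem_sdiff.2 ⟨heX i, hiT⟩), h1]
    have h3 : Z.card = B.card - 1 - 1 := by
      rw [Finset.card_erase_of_mem (Finset.mem_erase.2
        ⟨heij.symm, Finset.mem_sdiff.2 ⟨heX j, hjT⟩⟩), h2]
    omega
  have hZE : (Z : Set α) ⊆ M.E := by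
    intro x hx
    exact hXE (Finset.mem_sdiff.1 (Finset.mem_of_mem_erase (Finset.mem_of_mem_erase hx))).1
  have hin : ∀ (w : Fin 3 → ZMod 2) k l, ∑ k, w k * u k = 0 → w k = 1 → w l = 0 →
      (∀ x ∈ X, x ∉ T → x ≠ e k → x ≠ e l → x ∈ Z) →
      φ (e k) ∈ Submodule.span (ZMod 2) (φ '' (Z : Set α)) := by
    intro w k l hw hk hl hZ
    have h := hzero2 w
    rw [← Finset.add_sum_erase _ _ (heX k), hwe, hk, one_smul] at h
    rw [eq_neg_of_add_eq_zero_left h]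
    apply Submodule.neg_mem
    apply Submodule.sum_mem
    intro x hx
    obtain ⟨hxk, hxX⟩ := Finset.mem_erase.1 hx
    by_cases hxT : x ∈ T
    · rw [hvan w hw x hxT, zero_smul]; exact Submodule.zero_mem _
    by_cases hxl : x = e l
    · rw [hxl, hwe, hl, zero_smul]; exact Submodule.zero_mem _
    exact Submodule.smul_mem _ _ (Submodule.subset_span ⟨x, hZ x hxX hxT hxk hxl, rfl⟩)
  have hZi := hin w1 i j ho1 h1i h1j (fun x h1 h2 h3 h4 => by simp [Z, h1, h2, h3, h4])
  have hZj := hin w2 j i ho2 h2j h2i (fun x h1 h2 h3 h4 => by simp [Z, h1, h2, h3, h4])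
  obtain ⟨C, hC⟩ := M.exists_isBasis (Z : Set α) hZE
  have hCZ : C ⊆ (Z : Set α) := hC.subset
  have hle : Submodule.span (ZMod 2) (φ '' (Z : Set α)) ≤ Submodule.span (ZMod 2) (φ '' C) := by
    rw [Submodule.span_le]
    rintro _ ⟨x, hx, rfl⟩
    exact hspan C hC.indep x (hZE hx) (hC.subset_closure hx)
  have hiC : e i ∉ C := fun h => by have := hCZ h; simp [Z] at this
  have hjC : e j ∉ C := fun h => by have := hCZ h; simp [Z] at this
  have hi := hclos C hC.indep _ (heS i).1 (hle hZi) hiC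
  have hj := hclos C hC.indep _ (heS j).1 (hle hZj) hjC
  obtain ⟨B', hB', hCB'⟩ := hC.indep.exists_isBase_superset
  have hB'f : B'.Finite := hEfin.subset hB'.subset_ground
  have hCf : C.Finite := hB'f.subset hCB'
  have hCc : C.ncard ≤ Z.card := by
    rw [← Set.ncard_coe_finset Z]
    exact Set.ncard_le_ncard hCZ (Finset.finite_toSet _)
  have hB'c : B'.ncard = B.card := by
    rw [hB'.ncard_eq_ncard_of_isBase hB0, Set.ncard_coe_finset]
  have hd : 1 < (B' \ C).ncard := by
    rw [Set.ncard_sdiff hCB' hCf]; omega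
  obtain ⟨b1, hb1, b2, hb2, hb12⟩ := (Set.one_lt_ncard (hB'f.subset sdiff_subset)).1 hd
  exact minor_aux M B' C hB' hCB' (e i) (e j) b1 b2 heij hb12 hb1.1 hb2.1 hb1.2 hb2.2 hi hj hiC hjC hu

end Matroid
end

section
/- Let M be a simple, cosimple, binary matroid. If M is (2,2)-uniform, then min{r(M), r*(M)} ≤ 5, where r*(M) denotes the rank of the dual matroid M*. -/
open Set

namespace Matroid

variable {α β : Type*}

/-! ### A finite search: no `6 × 6` binary matrix satisfies the local conditions -/

/-- Filter a list in continuation-passing style (so that the kernel evaluates eagerly). -/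
def filterK (p : ℕ → Bool) (k : List ℕ → Bool) : List ℕ → List ℕ → Bool
  | [], acc => k acc
  | x :: xs, acc => bif p x then filterK p k xs (x :: acc) else filterK p k xs acc

lemma filterK_eq (p : ℕ → Bool) (k : List ℕ → Bool) (l acc : List ℕ) :
    filterK p k l acc = k ((l.filter p).reverse ++ acc) := by
  induction l generalizing acc with
  | nil => simp [filterK]
  | cons x xs ih =>
    cases h : p x <;> simp [filterK, h, ih]

/-- All elements of a list satisfying `p` (after filtering by `q`). -/
def branch (q : ℕ → Bool) (l : List ℕ) (k : List ℕ → ℕ → Bool) : Bool :=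
  filterK q (fun c => c.all (k c)) l []

lemma branch_elim {q : ℕ → Bool} {l : List ℕ} {k : List ℕ → ℕ → Bool}
    (h : branch q l k = true) :
    ∃ c : List ℕ, (∀ x, x ∈ c ↔ x ∈ l ∧ q x = true) ∧ ∀ x ∈ c, k c x = true := by
  rw [branch, filterK_eq, List.append_nil, List.all_eq_true] at h
  exact ⟨_, fun x => by simp, h⟩

/-- Bit lookup in a table. -/
def lookupBit (t x : ℕ) : Bool := Nat.beq (Nat.land (Nat.shiftRight t x) 1) 1

/-- At least five of the six bits are set. -/
def pge5 (x : ℕ) : Bool := lookupBit 16753531353454084096 x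
/-- At least four of the six bits are set. -/
def pge4 (x : ℕ) : Bool := lookupBit 18368186720584761344 x
/-- At least three of the six bits are set. -/
def pge3 (x : ℕ) : Bool := lookupBit 18446461400418674816 x

/-- The condition on pairs of columns. -/
def cond2 (a b : ℕ) : Bool := pge5 (Nat.lor a b)

/-- The condition on triples of columns. -/
def cond3 (a b c : ℕ) : Bool :=
  pge4 (Nat.lor a (Nat.xor b c)) && (pge4 (Nat.lor b (Nat.xor a c)) &&
  (pge4 (Nat.lor c (Nat.xor a b)) && pge4 (Nat.lor (Nat.xor a c) (Nat.xor b c))))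

/-- One condition on quadruples of columns. -/
def cond4' (a b c d : ℕ) : Bool :=
  pge3 (Nat.lor (Nat.xor a (Nat.xor c d)) (Nat.xor a b))

/-- The condition on quadruples of columns. -/
def cond4 (a b c d : ℕ) : Bool :=
  cond4' a b c d && (cond4' a c b d && (cond4' a d b c && (cond4' b c a d &&
    (cond4' b d a c && cond4' c d a b))))

/-- The search. -/
def searchAll : Bool :=
  [63, 62, 60, 56, 48, 32, 0].all fun a0 =>
  branch (cond2 a0) [0, 1, 2, 3, 4, 5, 6, 7, 8, 9, 10, 11, 12, 13, 14, 15, 16, 17, 18, 19, 20, 21,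
    22, 23, 24, 25, 26, 27, 28, 29, 30, 31, 32, 33, 34, 35, 36, 37, 38, 39, 40, 41, 42, 43, 44,
    45, 46, 47, 48, 49, 50, 51, 52, 53, 54, 55, 56, 57, 58, 59, 60, 61, 62, 63] fun l1 a1 =>
  branch (fun d => Nat.ble a1 d && (cond2 a1 d && cond3 a0 a1 d)) l1 fun l2 a2 =>
  branch (fun d => Nat.ble a2 d && (cond2 a2 d && (cond3 a0 a2 d && (cond3 a1 a2 d &&
    cond4 a0 a1 a2 d)))) l2 fun l3 a3 =>
  branch (fun d => Nat.ble a3 d && (cond2 a3 d && (cond3 a0 a3 d && (cond3 a1 a3 d &&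
    (cond3 a2 a3 d && (cond4 a0 a1 a3 d && (cond4 a0 a2 a3 d && cond4 a1 a2 a3 d)))))))
    l3 fun l4 a4 =>
  branch (fun d => Nat.ble a4 d && (cond2 a4 d && (cond3 a0 a4 d && (cond3 a1 a4 d &&
    (cond3 a2 a4 d && (cond3 a3 a4 d &&
    (cond4 a0 a1 a4 d && (cond4 a0 a2 a4 d && (cond4 a1 a2 a4 d && (cond4 a0 a3 a4 d &&
    (cond4 a1 a3 a4 d && cond4 a2 a3 a4 d)))))))))))
    l4 fun _ _ => false

lemma searchAll_eq : searchAll = true := by decide +kernel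

lemma search_false (a : Fin 6 → ℕ) (h0 : a 0 ∈ [63, 62, 60, 56, 48, 32, 0])
    (hlt : ∀ i, a i < 64) (h12 : a 1 ≤ a 2) (h23 : a 2 ≤ a 3) (h34 : a 3 ≤ a 4) (h45 : a 4 ≤ a 5)
    (c2 : ∀ i j, i ≠ j → cond2 (a i) (a j) = true)
    (c3 : ∀ i j k, i ≠ j → i ≠ k → j ≠ k → cond3 (a i) (a j) (a k) = true)
    (c4 : ∀ i j k l, i ≠ j → i ≠ k → i ≠ l → j ≠ k → j ≠ l → k ≠ l →
      cond4 (a i) (a j) (a k) (a l) = true) : False := by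
  have h := searchAll_eq
  rw [searchAll, List.all_eq_true] at h
  have hb : ∀ {x y}, x ≤ y → Nat.ble x y = true := fun h => Nat.ble_eq_true_of_le h
  have h13 := h12.trans h23
  have h14 := h13.trans h34
  have h15 := h14.trans h45
  have h24 := h23.trans h34
  have h25 := h24.trans h45
  have h35 := h34.trans h45
  have h64 : ∀ x, x < 64 → x ∈ [0, 1, 2, 3, 4, 5, 6, 7, 8, 9, 10, 11, 12, 13, 14, 15, 16, 17, 18,
    19, 20, 21,
    22, 23, 24, 25, 26, 27, 28, 29, 30, 31, 32, 33, 34, 35, 36, 37, 38, 39, 40, 41, 42, 43, 44,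
    45, 46, 47, 48, 49, 50, 51, 52, 53, 54, 55, 56, 57, 58, 59, 60, 61, 62, 63] := by decide
  obtain ⟨l1, m1, h⟩ := branch_elim (h _ h0)
  have m1' : ∀ i, i ≠ 0 → a i ∈ l1 := fun i hi =>
    (m1 _).2 ⟨h64 _ (hlt i), c2 0 i (Ne.symm hi)⟩
  obtain ⟨l2, m2, h⟩ := branch_elim (h (a 1) (m1' 1 (by decide)))
  have m2' : ∀ i, i ≠ 0 → i ≠ 1 → a 1 ≤ a i → a i ∈ l2 := fun i hi0 hi1 hle =>
    (m2 _).2 ⟨m1' i hi0, by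
      simp only [hb hle, c2 1 i hi1.symm, c3 0 1 i (by decide) hi0.symm hi1.symm, Bool.and_self]⟩
  obtain ⟨l3, m3, h⟩ := branch_elim (h (a 2) (m2' 2 (by decide) (by decide) h12))
  have m3' : ∀ i, i ≠ 0 → i ≠ 1 → i ≠ 2 → a 1 ≤ a i → a 2 ≤ a i → a i ∈ l3 :=
    fun i hi0 hi1 hi2 hle1 hle => (m3 _).2 ⟨m2' i hi0 hi1 hle1, by
      simp only [hb hle, c2 2 i hi2.symm, c3 0 2 i (by decide) hi0.symm hi2.symm,
        c3 1 2 i (by decide) hi1.symm hi2.symm,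
        c4 0 1 2 i (by decide) (by decide) hi0.symm (by decide) hi1.symm hi2.symm, Bool.and_self]⟩
  obtain ⟨l4, m4, h⟩ := branch_elim (h (a 3) (m3' 3 (by decide) (by decide) (by decide) h13 h23))
  have m4' : ∀ i, i ≠ 0 → i ≠ 1 → i ≠ 2 → i ≠ 3 → a 1 ≤ a i → a 2 ≤ a i → a 3 ≤ a i → a i ∈ l4 :=
    fun i hi0 hi1 hi2 hi3 hle1 hle2 hle => (m4 _).2 ⟨m3' i hi0 hi1 hi2 hle1 hle2, by
      simp only [hb hle, c2 3 i hi3.symm, c3 0 3 i (by decide) hi0.symm hi3.symm,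
        c3 1 3 i (by decide) hi1.symm hi3.symm, c3 2 3 i (by decide) hi2.symm hi3.symm,
        c4 0 1 3 i (by decide) (by decide) hi0.symm (by decide) hi1.symm hi3.symm,
        c4 0 2 3 i (by decide) (by decide) hi0.symm (by decide) hi2.symm hi3.symm,
        c4 1 2 3 i (by decide) (by decide) hi1.symm (by decide) hi2.symm hi3.symm,
        Bool.and_self]⟩
  obtain ⟨l5, m5, h⟩ := branch_elim
    (h (a 4) (m4' 4 (by decide) (by decide) (by decide) (by decide) h14 h24 h34))
  have := h (a 5) ((m5 _).2 ⟨m4' 5 (by decide) (by decide) (by decide) (by decide) h15 h25 h35, by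
    simp only [hb h45, c2 4 5 (by decide), c3 0 4 5 (by decide) (by decide) (by decide),
      c3 1 4 5 (by decide) (by decide) (by decide), c3 2 4 5 (by decide) (by decide) (by decide),
      c3 3 4 5 (by decide) (by decide) (by decide),
      c4 0 1 4 5 (by decide) (by decide) (by decide) (by decide) (by decide) (by decide),
      c4 0 2 4 5 (by decide) (by decide) (by decide) (by decide) (by decide) (by decide),
      c4 1 2 4 5 (by decide) (by decide) (by decide) (by decide) (by decide) (by decide),
      c4 0 3 4 5 (by decide) (by decide) (by decide) (by decide) (by decide) (by decide),
      c4 1 3 4 5 (by decide) (by decide) (by decide) (by decide) (by decide) (by decide),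
      c4 2 3 4 5 (by decide) (by decide) (by decide) (by decide) (by decide) (by decide),
      Bool.and_self]⟩)
  exact Bool.false_ne_true this

/-- Number of set bits among the first six. -/
def pop6 (x : ℕ) : ℕ := ∑ i : Fin 6, (x.testBit i).toNat

lemma pge5_iff : ∀ x < 64, 5 ≤ pop6 x → pge5 x = true := by decide +kernel
lemma pge4_iff : ∀ x < 64, 4 ≤ pop6 x → pge4 x = true := by decide +kernel
lemma pge3_iff : ∀ x < 64, 3 ≤ pop6 x → pge3 x = true := by decide +kernel

lemma pop6_add_card (x : ℕ) (p : Fin 6 → Prop) [DecidablePred p]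
    (hp : ∀ i : Fin 6, x.testBit i = false → p i) :
    6 ≤ pop6 x + (Finset.univ.filter p).card := by
  have h1 : pop6 x + ∑ i : Fin 6, (if p i then 1 else 0) ≥ ∑ i : Fin 6, 1 := by
    rw [pop6, ← Finset.sum_add_distrib]
    refine Finset.sum_le_sum fun i _ => ?_
    cases h : x.testBit i
    · simp [hp i h]
    · simp
  rw [Finset.card_filter]
  simpa using h1

/-- The local conditions on a `6 × 6` matrix. -/
structure LocalCond (A : Fin 6 → Fin 6 → Bool) : Prop where
  h2 : ∀ i j, i ≠ j → (Finset.univ.filter fun b => A b i = false ∧ A b j = false).card ≤ 1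
  h3a : ∀ i j k, i ≠ j → i ≠ k → j ≠ k →
    (Finset.univ.filter fun b => A b i = false ∧ A b j = A b k).card ≤ 2
  h3b : ∀ i j k, i ≠ j → i ≠ k → j ≠ k →
    (Finset.univ.filter fun b => A b i = A b k ∧ A b j = A b k).card ≤ 2
  h4 : ∀ i j k l, i ≠ j → i ≠ k → i ≠ l → j ≠ k → j ≠ l → k ≠ l →
    (Finset.univ.filter fun b => A b i = xor (A b k) (A b l) ∧ A b i = A b j).card ≤ 3

lemma sorted_code : ∀ b0 b1 b2 b3 b4 b5 : Bool, b0 ≤ b1 → b1 ≤ b2 → b2 ≤ b3 → b3 ≤ b4 → b4 ≤ b5 →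
    Nat.ofBits ![b0, b1, b2, b3, b4, b5] ∈ [63, 62, 60, 56, 48, 32, 0] := by decide

lemma matrix_false (A : Fin 6 → Fin 6 → Bool) (hA : LocalCond A)
    (hrow : Monotone fun b => A b 0)
    (hcol : Monotone fun j : Fin 5 => Nat.ofBits fun b => A b j.succ) : False := by
  obtain ⟨c, hc⟩ : ∃ c : Fin 6 → ℕ, ∀ j, c j = Nat.ofBits (fun b => A b j) := ⟨_, fun _ => rfl⟩
  have hlt : ∀ j, c j < 64 := fun j => by rw [hc]; exact Nat.ofBits_lt_two_pow _
  have hbit : ∀ j (i : Fin 6), (c j).testBit i = A i j := fun j i => by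
    rw [hc]; exact Nat.testBit_ofBits_lt _ _ i.2
  have hcol' : ∀ i j : Fin 5, i ≤ j → c i.succ ≤ c j.succ := fun i j hij => by
    rw [hc, hc]; exact hcol hij
  have hor : ∀ {x y : ℕ}, x < 64 → y < 64 → x ||| y < 64 := fun h h' =>
    Nat.or_lt_two_pow (n := 6) h h'
  have hxor : ∀ {x y : ℕ}, x < 64 → y < 64 → x ^^^ y < 64 := fun h h' =>
    Nat.xor_lt_two_pow (n := 6) h h'
  have e3a : ∀ i j k, i ≠ j → i ≠ k → j ≠ k → pge4 (Nat.lor (c i)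
      (Nat.xor (c j) (c k))) = true := by
    intro i j k hij hik hjk
    change pge4 (_ ||| (_ ^^^ _)) = true
    refine pge4_iff _ (hor (hlt _) (hxor (hlt _) (hlt _))) ?_
    have := pop6_add_card ((c i) |||
      ((c j) ^^^ (c k)))
      (fun b => A b i = false ∧ A b j = A b k) (fun b hb => by
        rw [Nat.testBit_or, Nat.testBit_xor, hbit, hbit, hbit] at hb
        revert hb; cases A b i <;> cases A b j <;> cases A b k <;> simp)
    have h' := hA.h3a i j k hij hik hjk
    omega
  have e3b : ∀ i j k, i ≠ j → i ≠ k → j ≠ k → pge4 (Nat.lor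
      (Nat.xor (c i) (c k))
      (Nat.xor (c j) (c k))) = true := by
    intro i j k hij hik hjk
    change pge4 ((_ ^^^ _) ||| (_ ^^^ _)) = true
    refine pge4_iff _ (hor (hxor (hlt _) (hlt _)) (hxor (hlt _) (hlt _))) ?_
    have := pop6_add_card (((c i) ^^^ (c k)) |||
      ((c j) ^^^ (c k)))
      (fun b => A b i = A b k ∧ A b j = A b k) (fun b hb => by
        rw [Nat.testBit_or, Nat.testBit_xor, Nat.testBit_xor, hbit, hbit, hbit] at hb
        revert hb; cases A b i <;> cases A b j <;> cases A b k <;> simp)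
    have h' := hA.h3b i j k hij hik hjk
    omega
  have e4 : ∀ i j k l, i ≠ j → i ≠ k → i ≠ l → j ≠ k → j ≠ l → k ≠ l →
      cond4' (c i) (c j) (c k)
        (c l) = true := by
    intro i j k l hij hik hil hjk hjl hkl
    change pge3 ((_ ^^^ (_ ^^^ _)) ||| (_ ^^^ _)) = true
    refine pge3_iff _ (hor (hxor (hlt _) (hxor (hlt _) (hlt _))) (hxor (hlt _) (hlt _))) ?_
    have := pop6_add_card (((c i) ^^^ ((c k) ^^^
      (c l))) |||
      ((c i) ^^^ (c j)))
      (fun b => A b i = xor (A b k) (A b l) ∧ A b i = A b j) (fun b hb => by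
        rw [Nat.testBit_or, Nat.testBit_xor, Nat.testBit_xor, Nat.testBit_xor,
          hbit, hbit, hbit, hbit] at hb
        revert hb; cases A b i <;> cases A b j <;> cases A b k <;> cases A b l <;> simp)
    have h' := hA.h4 i j k l hij hik hil hjk hjl hkl
    omega
  refine search_false c ?_ hlt
    (hcol' _ _ (show (0 : Fin 5) ≤ 1 by decide)) (hcol' _ _ (show (1 : Fin 5) ≤ 2 by decide))
    (hcol' _ _ (show (2 : Fin 5) ≤ 3 by decide)) (hcol' _ _ (show (3 : Fin 5) ≤ 4 by decide)) ?_ ?_ ?_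
  · have := sorted_code (A 0 0) (A 1 0) (A 2 0) (A 3 0) (A 4 0) (A 5 0) (hrow (by decide))
      (hrow (by decide)) (hrow (by decide)) (hrow (by decide)) (hrow (by decide))
    rw [hc]
    convert this using 2
    funext b
    fin_cases b <;> rfl
  · intro i j hij
    change pge5 (_ ||| _) = true
    refine pge5_iff _ (hor (hlt _) (hlt _)) ?_
    have := pop6_add_card ((c i) ||| (c j))
      (fun b => A b i = false ∧ A b j = false)
      (fun b hb => by
        rw [Nat.testBit_or, hbit, hbit] at hb
        simpa using hb)
    have h' := hA.h2 i j hij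
    omega
  · intro i j k hij hik hjk
    simp only [cond3, e3a i j k hij hik hjk, e3a j i k hij.symm hjk hik,
      e3a k i j hik.symm hjk.symm hij, e3b i j k hij hik hjk, Bool.and_self]
  · intro i j k l hij hik hil hjk hjl hkl
    simp only [cond4, e4 i j k l hij hik hil hjk hjl hkl,
      e4 i k j l hik hij hil hjk.symm hkl hjl,
      e4 i l j k hil hij hik hjl.symm hkl.symm hjk,
      e4 j k i l hjk hij.symm hjl hik.symm hkl hil,
      e4 j l i k hjl hij.symm hjk hil.symm hkl.symm hik,
      e4 k l i j hkl hik.symm hjk.symm hil.symm hjl.symm hij, Bool.and_self]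

/-! ### The matroid part -/

lemma no_excess (M : Matroid α) (hfin : M.Finite) (hu : M.KLUniform 2 2) {B Y : Set α} {x y : α}
    (hB : M.IsBase B) (hYE : Y ⊆ M.E) (hYc : Y.ncard + 2 ≤ B.ncard) (hxy : x ≠ y)
    (hxY : x ∉ Y) (hyY : y ∉ Y) (hx : x ∈ M.closure Y) (hy : y ∈ M.closure Y) : False := by
  classical
  obtain ⟨I, hI⟩ := M.exists_isBasis Y hYE
  obtain ⟨B', hB', hIB'⟩ := hI.indep.exists_isBase_superset
  have hYfin : Y.Finite := M.ground_finite.subset hYE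
  have hB'fin : B'.Finite := M.ground_finite.subset hB'.subset_ground
  have hIY : I.ncard ≤ Y.ncard := Set.ncard_le_ncard hI.subset hYfin
  have hBB : B.ncard = B'.ncard := hB.ncard_eq_ncard_of_isBase hB'
  have hdiff : 1 < (B' \ I).ncard := by
    have := Set.ncard_sdiff_add_ncard_of_subset hIB' hB'fin
    omega
  obtain ⟨p, q, hp, hq, hpq⟩ := (Set.one_lt_ncard_iff (hB'fin.subset sdiff_subset)).1 hdiff
  rw [← hI.closure_eq_closure] at hx hy
  have hxI : x ∉ I := fun h => hxY (hI.subset h)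
  have hyI : y ∉ I := fun h => hyY (hI.subset h)
  have hxE : x ∈ M.E := M.closure_subset_ground _ hx
  have hyE : y ∈ M.E := M.closure_subset_ground _ hy
  have hpE : p ∈ M.E := hB'.subset_ground hp.1
  have hqE : q ∈ M.E := hB'.subset_ground hq.1
  have hxd : ∀ J, x ∈ J → ¬ M.Indep (J ∪ I) := fun J hJ hind => by
    have h1 := (hI.indep.mem_closure_iff.1 hx).resolve_right hxI
    exact h1.not_indep (hind.subset (insert_subset (Or.inl hJ) subset_union_right))
  have hyd : ∀ J, y ∈ J → ¬ M.Indep (J ∪ I) := fun J hJ hind => by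
    have h1 := (hI.indep.mem_closure_iff.1 hy).resolve_right hyI
    exact h1.not_indep (hind.subset (insert_subset (Or.inl hJ) subset_union_right))
  have hpqi : ∀ J, J ⊆ {p, q} → M.Indep (J ∪ I) := fun J hJ => hB'.indep.subset
    (union_subset (fun z hz => by
      rcases hJ hz with rfl | rfl
      exacts [hp.1, hq.1]) hIB')
  have hxB : x ∉ B' := fun h => hxd {x} rfl (hB'.indep.subset
    (union_subset (singleton_subset_iff.2 h) hIB'))
  have hyB : y ∉ B' := fun h => hyd {y} rfl (hB'.indep.subset
    (union_subset (singleton_subset_iff.2 h) hIB'))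
  have hpx : p ≠ x := fun h => hxB (h ▸ hp.1)
  have hpy : p ≠ y := fun h => hyB (h ▸ hp.1)
  have hqx : q ≠ x := fun h => hxB (h ▸ hq.1)
  have hqy : q ≠ y := fun h => hyB (h ▸ hq.1)
  have hIE : I ⊆ M.E := hI.indep.subset_ground
  let R : Set α := {p, q, x, y}
  have hRI : Disjoint R I := by
    rw [Set.disjoint_left]
    rintro z (rfl | rfl | rfl | rfl)
    exacts [hp.2, hq.2, hxI, hyI]
  have hRE : R ⊆ M.E := by
    rintro z (rfl | rfl | rfl | rfl)
    exacts [hpE, hqE, hxE, hyE]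
  let N : Matroid α := (M.contractS I).deleteS (M.E \ (I ∪ R))
  have hNE : N.E = R := by
    change (M.E \ I) \ (M.E \ (I ∪ R)) = R
    ext z
    constructor
    · rintro ⟨⟨h1, h2⟩, h3⟩
      by_contra h
      exact h3 ⟨h1, fun h' => h'.elim h2 h⟩
    · intro h
      exact ⟨⟨hRE h, fun h' => Set.disjoint_left.1 hRI h h'⟩, fun h' => h'.2 (Or.inr h)⟩
  have hNI : ∀ J ⊆ R, (N.Indep J ↔ J ⊆ {p, q}) := by
    intro J hJ
    have h1 : N.Indep J ↔ (M.contract I).Indep J ∧ J ⊆ N.E := restrict_indep_iff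
    rw [h1, hNE, hI.indep.contract_indep_iff]
    constructor
    · rintro ⟨⟨-, h⟩, -⟩ z hz
      rcases hJ hz with rfl | rfl | rfl | rfl
      · exact Or.inl rfl
      · exact Or.inr rfl
      · exact (hxd _ hz h).elim
      · exact (hyd _ hz h).elim
    · intro h
      exact ⟨⟨hRI.mono_left hJ, hpqi J h⟩, hJ⟩
  refine hu ⟨N, ⟨I, M.E \ (I ∪ R), hIE, sdiff_subset, ?_, rfl⟩, ?_⟩
  · rw [Set.disjoint_left]
    exact fun z hz h => h.2 (Or.inl hz)
  let f : Fin 4 → α := ![p, q, x, y]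
  have hfinj : Function.Injective f := by
    intro i j hij
    fin_cases i <;> fin_cases j <;> simp_all [f, eq_comm]
  have hfR : Set.range f = N.E := by
    rw [hNE]
    ext z
    simp [f, R, eq_comm]
    tauto
  let e₁ : Fin 4 ≃ N.E := (Equiv.ofInjective f hfinj).trans (Equiv.setCongr hfR)
  let e₂ : N.E ≃ (freeLoopy 2 2).E := e₁.symm.trans (Equiv.Set.univ (Fin 4)).symm
  have he1 : ∀ i, ((e₁ i : N.E) : α) = f i := fun i => rfl
  refine ⟨e₂, fun J => ?_⟩
  rw [hNI _ (by rw [← hNE]; rintro _ ⟨z, -, rfl⟩; exact z.2)]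
  refine Iff.trans ?_ (uniqueBaseOn_indep_iff (subset_univ _)).symm
  constructor
  · rintro h _ ⟨_, ⟨z, hz, rfl⟩, rfl⟩
    obtain ⟨i, rfl⟩ := e₁.surjective z
    have h1 : f i ∈ ({p, q} : Set α) := h ⟨_, hz, he1 i⟩
    have h2 : ((e₂ (e₁ i) : (freeLoopy 2 2).E) : Fin 4) = i := e₁.symm_apply_apply i
    change (((e₂ (e₁ i) : (freeLoopy 2 2).E) : Fin 4) : ℕ) < 2
    rw [h2]
    fin_cases i
    · decide
    · decide
    · exact (h1.elim (fun h => hpx h.symm) (fun h => hqx (Eq.symm h))).elim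
    · exact (h1.elim (fun h => hpy h.symm) (fun h => hqy (Eq.symm h))).elim
  · rintro h _ ⟨z, hz, rfl⟩
    obtain ⟨i, rfl⟩ := e₁.surjective z
    have h2 : ((e₂ (e₁ i) : (freeLoopy 2 2).E) : Fin 4) = i := e₁.symm_apply_apply i
    have h1 : (((e₂ (e₁ i) : (freeLoopy 2 2).E) : Fin 4) : ℕ) < 2 := h ⟨_, ⟨_, hz, rfl⟩, rfl⟩
    rw [h2] at h1
    rw [he1]
    fin_cases i
    · exact Or.inl rfl
    · exact Or.inr rfl
    · exact absurd h1 (by decide)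
    · exact absurd h1 (by decide)

section Rep

variable {W : Type} [AddCommGroup W] [Module (ZMod 2) W]

lemma rep_indep {M : Matroid α} {φ : α → W}
    (hφ : ∀ I ⊆ M.E, (M.Indep I ↔ Set.InjOn φ I ∧ LinearIndependent (ZMod 2) (fun x : I => φ x)))
    {I : Set α} (hI : I ⊆ M.E) : M.Indep I ↔ LinearIndepOn (ZMod 2) φ I := by
  rw [hφ I hI]
  exact ⟨fun h => h.2, fun h => ⟨h.injOn, h⟩⟩

lemma rep_closure {M : Matroid α} {φ : α → W}
    (hφ : ∀ I ⊆ M.E, (M.Indep I ↔ Set.InjOn φ I ∧ LinearIndependent (ZMod 2) (fun x : I => φ x)))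
    {I : Set α} {x : α} (hI : M.Indep I) (hx : x ∈ M.E) :
    x ∈ M.closure I ↔ φ x ∈ Submodule.span (ZMod 2) (φ '' I) := by
  have hIE := hI.subset_ground
  have hli := (rep_indep hφ hIE).1 hI
  rw [hI.mem_closure_iff, ← not_iff_not, hli.notMem_span_iff, not_or,
    ← rep_indep hφ (insert_subset hx hIE), not_dep_iff (insert_subset hx hIE)]

lemma rep_closure_of_mem {M : Matroid α} {φ : α → W}
    (hφ : ∀ I ⊆ M.E, (M.Indep I ↔ Set.InjOn φ I ∧ LinearIndependent (ZMod 2) (fun x : I => φ x)))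
    {Y : Set α} {x : α} (hY : Y ⊆ M.E) (hx : x ∈ M.E)
    (h : φ x ∈ Submodule.span (ZMod 2) (φ '' Y)) : x ∈ M.closure Y := by
  obtain ⟨I, hI⟩ := M.exists_isBasis Y hY
  rw [← hI.closure_eq_closure, rep_closure hφ hI.indep hx]
  refine (Submodule.span_le.2 ?_ : Submodule.span (ZMod 2) (φ '' Y) ≤ _) h
  rintro _ ⟨y, hy, rfl⟩
  exact (rep_closure hφ hI.indep (hY hy)).1 (hI.subset_closure hy)

lemma key (M : Matroid α) (hfin : M.Finite) (hu : M.KLUniform 2 2) {φ : α → W}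
    (hφ : ∀ I ⊆ M.E, (M.Indep I ↔ Set.InjOn φ I ∧ LinearIndependent (ZMod 2) (fun x : I => φ x)))
    {B : Finset α} (hB : M.IsBase B) (g : α → α → ZMod 2)
    (hg : ∀ e ∈ M.E \ (B : Set α), φ e = ∑ b ∈ B, g e b • φ b)
    (x y : α) (K K₁ K₂ Z : Finset α) (hx : x ∈ M.E \ (B : Set α)) (hy : y ∈ M.E \ (B : Set α))
    (hK : ∀ k ∈ K, k ∈ M.E \ (B : Set α)) (hxy : x ≠ y) (hxK : x ∉ K) (hyK : y ∉ K)
    (hK₁ : K₁ ⊆ K) (hK₂ : K₂ ⊆ K) (hZ : Z ⊆ B) (hZc : K.card + 2 ≤ Z.card)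
    (h1 : ∀ z ∈ Z, g x z + ∑ k ∈ K₁, g k z = 0)
    (h2 : ∀ z ∈ Z, g y z + ∑ k ∈ K₂, g k z = 0) : False := by
  classical
  have hYE : ((K ∪ (B \ Z) : Finset α) : Set α) ⊆ M.E := by
    intro z hz
    rcases Finset.mem_union.1 (Finset.mem_coe.1 hz) with hz | hz
    · exact (hK z hz).1
    · exact hB.subset_ground (Finset.mem_coe.2 (Finset.mem_sdiff.1 hz).1)
  have main : ∀ x ∈ M.E \ (B : Set α), ∀ K₁ ⊆ K, (∀ z ∈ Z, g x z + ∑ k ∈ K₁, g k z = 0) →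
      x ∈ M.closure ((K ∪ (B \ Z) : Finset α) : Set α) := by
    intro x hx K₁ hK₁ h1
    refine rep_closure_of_mem hφ hYE hx.1 ?_
    have hsum : φ x + ∑ k ∈ K₁, φ k = ∑ b ∈ B, (g x b + ∑ k ∈ K₁, g k b) • φ b := by
      rw [hg x hx, Finset.sum_congr rfl (fun k hk => hg k (hK k (hK₁ hk))), Finset.sum_comm,
        ← Finset.sum_add_distrib]
      refine Finset.sum_congr rfl fun b _ => ?_
      rw [add_smul, Finset.sum_smul]
    rw [eq_sub_of_add_eq hsum]
    refine Submodule.sub_mem _ (Submodule.sum_mem _ fun b hb => ?_)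
      (Submodule.sum_mem _ fun k hk => Submodule.subset_span ⟨k, by simp [hK₁ hk], rfl⟩)
    by_cases hbZ : b ∈ Z
    · rw [h1 b hbZ, zero_smul]; exact Submodule.zero_mem _
    · exact Submodule.smul_mem _ _ (Submodule.subset_span ⟨b, by simp [hb, hbZ], rfl⟩)
  have hnot : ∀ x ∈ M.E \ (B : Set α), x ∉ K → x ∉ ((K ∪ (B \ Z) : Finset α) : Set α) := by
    intro x hx hxK h
    rcases Finset.mem_union.1 (Finset.mem_coe.1 h) with h | h
    · exact hxK h
    · exact hx.2 (Finset.mem_coe.2 (Finset.mem_sdiff.1 h).1)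
  refine no_excess M hfin hu hB hYE ?_ hxy (hnot x hx hxK) (hnot y hy hyK)
    (main x hx K₁ hK₁ h1) (main y hy K₂ hK₂ h2)
  rw [Set.ncard_coe_finset, Set.ncard_coe_finset]
  have := Finset.card_union_le K (B \ Z)
  have h3 := Finset.card_sdiff_add_card_eq_card hZ
  omega

lemma exists_coord (M : Matroid α) {φ : α → W}
    (hφ : ∀ I ⊆ M.E, (M.Indep I ↔ Set.InjOn φ I ∧ LinearIndependent (ZMod 2) (fun x : I => φ x)))
    {B : Finset α} (hB : M.IsBase B) :
    ∃ g : α → α → ZMod 2, ∀ e ∈ M.E \ (B : Set α), φ e = ∑ b ∈ B, g e b • φ b := by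
  have : ∀ e, ∃ c : α → ZMod 2, e ∈ M.E \ (B : Set α) → φ e = ∑ b ∈ B, c b • φ b := by
    intro e
    by_cases he : e ∈ M.E \ (B : Set α)
    · have h1 : φ e ∈ Submodule.span (ZMod 2) (φ '' (B : Set α)) :=
        (rep_closure hφ hB.indep he.1).1 (by rw [hB.closure_eq]; exact he.1)
      obtain ⟨c, hc⟩ := (Submodule.mem_span_image_finset_iff_exists_fun (ZMod 2)).1 h1
      classical
      refine ⟨fun b => if h : b ∈ B then c ⟨b, h⟩ else 0, fun _ => ?_⟩
      rw [← hc, ← Finset.sum_coe_sort B]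
      exact Finset.sum_congr rfl fun b _ => by simp
    · exact ⟨0, fun h => (he h).elim⟩
  choose g hg using this
  exact ⟨g, hg⟩

lemma localCond_of (M : Matroid α) (hfin : M.Finite) (hu : M.KLUniform 2 2) {φ : α → W}
    (hφ : ∀ I ⊆ M.E, (M.Indep I ↔ Set.InjOn φ I ∧ LinearIndependent (ZMod 2) (fun x : I => φ x)))
    {B : Finset α} (hB : M.IsBase B) (g : α → α → ZMod 2)
    (hg : ∀ e ∈ M.E \ (B : Set α), φ e = ∑ b ∈ B, g e b • φ b)
    (b e : Fin 6 → α) (hb : ∀ i, b i ∈ B) (he : ∀ i, e i ∈ M.E \ (B : Set α))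
    (hbi : Function.Injective b) (hei : Function.Injective e) :
    LocalCond (fun i j => decide (g (e j) (b i) = 1)) := by
  classical
  have gen : ∀ (i j : Fin 6) (K K₁ K₂ : Finset (Fin 6)) (p : Fin 6 → Prop) [DecidablePred p],
      i ≠ j → i ∉ K → j ∉ K → K₁ ⊆ K → K₂ ⊆ K →
      (∀ z, p z → g (e i) (b z) + ∑ k ∈ K₁, g (e k) (b z) = 0) →
      (∀ z, p z → g (e j) (b z) + ∑ k ∈ K₂, g (e k) (b z) = 0) →
      (Finset.univ.filter p).card ≤ K.card + 1 := by
    intro i j K K₁ K₂ p _ hij hiK hjK hK₁ hK₂ h1 h2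
    by_contra hcard
    refine key M hfin hu hφ hB g hg (e i) (e j) (K.map ⟨e, hei⟩) (K₁.map ⟨e, hei⟩)
      (K₂.map ⟨e, hei⟩) ((Finset.univ.filter p).map ⟨b, hbi⟩) (he i) (he j) ?_ (hei.ne hij)
      ?_ ?_ (Finset.map_subset_map.2 hK₁) (Finset.map_subset_map.2 hK₂) ?_ ?_ ?_ ?_
    · intro k hk
      obtain ⟨k, -, rfl⟩ := Finset.mem_map.1 hk
      exact he k
    · intro h
      obtain ⟨k, hk, h⟩ := Finset.mem_map.1 h
      exact hiK (hei h ▸ hk)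
    · intro h
      obtain ⟨k, hk, h⟩ := Finset.mem_map.1 h
      exact hjK (hei h ▸ hk)
    · intro z hz
      obtain ⟨k, -, rfl⟩ := Finset.mem_map.1 hz
      exact hb k
    · rw [Finset.card_map, Finset.card_map]; omega
    · intro z hz
      obtain ⟨k, hk, rfl⟩ := Finset.mem_map.1 hz
      rw [Finset.sum_map]
      exact h1 k (Finset.mem_filter.1 hk).2
    · intro z hz
      obtain ⟨k, hk, rfl⟩ := Finset.mem_map.1 hz
      rw [Finset.sum_map]
      exact h2 k (Finset.mem_filter.1 hk).2
  have z1 : ∀ u : ZMod 2, decide (u = 1) = false → u = 0 := by decide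
  have z2 : ∀ u v : ZMod 2, decide (u = 1) = decide (v = 1) → u + v = 0 := by decide
  have z3 : ∀ u v w : ZMod 2, decide (u = 1) = xor (decide (v = 1)) (decide (w = 1)) →
    u + (v + w) = 0 := by decide
  have z4 : ∀ u u' v w : ZMod 2, decide (u = 1) = xor (decide (v = 1)) (decide (w = 1)) →
    decide (u = 1) = decide (u' = 1) → u' + (v + w) = 0 := by decide
  constructor
  · intro i j hij
    refine (gen i j ∅ ∅ ∅ _ hij (by simp) (by simp) (by simp) (by simp) ?_ ?_).trans (by simp)
    · intro z hz; simpa using z1 _ hz.1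
    · intro z hz; simpa using z1 _ hz.2
  · intro i j k hij hik hjk
    refine (gen i j {k} ∅ {k} _ hij (by simpa) (by simpa) (by simp) (by simp) ?_ ?_).trans (by simp)
    · intro z hz; simpa using z1 _ hz.1
    · intro z hz; simpa using z2 _ _ hz.2
  · intro i j k hij hik hjk
    refine (gen i j {k} {k} {k} _ hij (by simpa) (by simpa) (by simp) (by simp) ?_ ?_).trans
      (by simp)
    · intro z hz; simpa using z2 _ _ hz.1
    · intro z hz; simpa using z2 _ _ hz.2
  · intro i j k l hij hik hil hjk hjl hkl
    refine (gen i j {k, l} {k, l} {k, l} _ hij (by simp [hik, hil]) (by simp [hjk, hjl])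
      (by simp) (by simp) ?_ ?_).trans (by rw [Finset.card_pair hkl])
    · intro z hz; rw [Finset.sum_pair hkl]; exact z3 _ _ _ hz.1
    · intro z hz; rw [Finset.sum_pair hkl]; exact z4 _ _ _ _ hz.1 hz.2

end Rep

lemma rankM_le (M : Matroid α) (hfin : M.Finite) {B : Set α} (hB : M.IsBase B) :
    M.rankM ≤ B.ncard := by
  refine csSup_le' ?_
  rintro n ⟨I, hI, -, rfl⟩
  obtain ⟨B', hB', hIB'⟩ := hI.exists_isBase_superset
  rw [hB.ncard_eq_ncard_of_isBase hB']
  exact Set.ncard_le_ncard hIB' (M.ground_finite.subset hB'.subset_ground)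

lemma exists_fin6 {s : Set α} (h : 6 ≤ s.ncard) :
    ∃ f : Fin 6 → α, Function.Injective f ∧ ∀ i, f i ∈ s := by
  obtain ⟨t, hts, htc⟩ := Set.exists_subset_card_eq h
  have htf : t.Finite := Set.finite_of_ncard_ne_zero (by omega)
  have hc : htf.toFinset.card = 6 := by rw [← Set.ncard_eq_toFinset_card t htf, htc]
  refine ⟨fun i => htf.toFinset.equivFin.symm (Fin.cast hc.symm i), ?_, fun i => hts ?_⟩
  · intro i j hij
    simpa using hij
  · exact htf.mem_toFinset.1 (htf.toFinset.equivFin.symm (Fin.cast hc.symm i)).2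

/-- a simple cosimple binary `(2,2)`-uniform matroid satisfies
`min {r(M), r*(M)} ≤ 5`. -/
theorem stmt16 {α : Type*} (M : Matroid α) (hfin : M.Finite)
    (hs : M.SimpleM) (hcs : M✶.SimpleM) (hbin : Matroid.RepOver (ZMod 2) M)
    (hu : M.KLUniform 2 2) : min M.rankM M✶.rankM ≤ 5 := by
  by_contra hmin
  have hr : 6 ≤ M.rankM := by omega
  have hr' : 6 ≤ M✶.rankM := by omega
  obtain ⟨W, _, _, φ, hφ⟩ := hbin
  obtain ⟨B₀, hB₀⟩ := M.exists_isBase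
  have hfB : B₀.Finite := M.ground_finite.subset hB₀.subset_ground
  obtain ⟨B, rfl⟩ := hfB.exists_finset_coe
  obtain ⟨g, hg⟩ := exists_coord M hφ hB₀
  have hc1 := hr.trans (rankM_le M hfin hB₀)
  have hc2 := hr'.trans (rankM_le M✶ ⟨M.ground_finite⟩ hB₀.compl_isBase_dual)
  obtain ⟨b, hbi, hb⟩ := exists_fin6 hc1
  obtain ⟨e, hei, he⟩ := exists_fin6 hc2
  let σ := Tuple.sort (fun i => decide (g (e 0) (b i) = 1))
  let code : Fin 6 → ℕ := fun j => Nat.ofBits fun i => decide (g (e j) (b (σ i)) = 1)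
  let τ := Tuple.sort (fun j : Fin 5 => code j.succ)
  let π : Fin 6 → Fin 6 := Fin.cons 0 (fun j => (τ j).succ)
  have hπ : Function.Injective π := by
    rw [Fin.cons_injective_iff]
    refine ⟨?_, (Fin.succ_injective 5).comp τ.injective⟩
    rintro ⟨j, hj⟩
    exact Fin.succ_ne_zero _ hj
  have hL := localCond_of M hfin hu hφ hB₀ g hg (b ∘ σ) (e ∘ π) (fun i => hb _) (fun i => he _)
    (hbi.comp σ.injective) (hei.comp hπ)
  refine matrix_false _ hL ?_ ?_
  · exact Tuple.monotone_sort (fun i => decide (g (e 0) (b i) = 1))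
  · exact Tuple.monotone_sort (fun j : Fin 5 => code j.succ)

end Matroid
end

section
/- A finite matroid M is (2,2)-uniform if and only if for every pair of distinct circuits C₁ and C₂ of M, the rank of C₁ ∪ C₂ in M is at least r(M) − 1. -/
open Set

namespace Matroid

variable {α β : Type*}

lemma rSet_cast {α : Type*} (M : Matroid α) [M.Finite] (X : Set α) :
    (M.rSet X : ℕ∞) = M.eRk X := by
  obtain ⟨I, hI⟩ := M.exists_isBasis' X
  have hfin : I.Finite := M.set_finite I hI.indep.subset_ground
  have key : IsGreatest {n : ℕ | ∃ I, M.Indep I ∧ I ⊆ X ∧ I.ncard = n} I.ncard := by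
    refine ⟨⟨I, hI.indep, hI.subset, rfl⟩, ?_⟩
    rintro n ⟨J, hJ, hJX, rfl⟩
    have h1 := hJ.encard_le_eRk_of_subset hJX
    rw [← hI.encard_eq_eRk, ← hfin.cast_ncard_eq,
      ← (M.set_finite J hJ.subset_ground).cast_ncard_eq] at h1
    exact_mod_cast h1
  rw [rSet, key.csSup_eq, hfin.cast_ncard_eq, hI.encard_eq_eRk]

lemma circuitM_iff {α : Type*} (M : Matroid α) (C : Set α) : M.CircuitM C ↔ M.IsCircuit C := by
  rw [isCircuit_iff_forall_ssubset, CircuitM, dep_iff]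
  tauto

lemma freeLoopy_indep (K : Set (Fin 4)) :
    (freeLoopy 2 2).Indep K ↔ ∀ i ∈ K, (i : ℕ) < 2 :=
  uniqueBaseOn_indep_iff (subset_univ _)

lemma mem_aux (K : Set (Fin 4)) : (2 ∉ K ∧ 3 ∉ K) ↔ ∀ i ∈ K, (i : ℕ) < 2 := by
  constructor
  · rintro ⟨h2, h3⟩ i hi
    fin_cases i
    · simp
    · simp
    · exact absurd hi h2
    · exact absurd hi h3
  · intro h
    exact ⟨fun h' ↦ by simpa using h _ h', fun h' ↦ by simpa using h _ h'⟩

/-- From four suitable elements, a minor isomorphic to `U_{2,2} ⊕ U_{0,2}`. -/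
lemma exists_minor {α : Type*} (M : Matroid α) {I : Set α} {a b e f : α}
    (hab : a ≠ b) (haI : a ∉ I) (hbI : b ∉ I) (hi : M.Indep (I ∪ {a, b}))
    (hef : e ≠ f) (heI : e ∉ I) (hfI : f ∉ I) (he : M.Dep (insert e I))
    (hf : M.Dep (insert f I)) : ¬ M.KLUniform 2 2 := by
  have hI : M.Indep I := hi.subset subset_union_left
  have hae : a ≠ e := by
    rintro rfl
    exact he.not_indep (hi.subset (by intro x; simp; tauto))
  have haf : a ≠ f := by
    rintro rfl
    exact hf.not_indep (hi.subset (by intro x; simp; tauto))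
  have hbe : b ≠ e := by
    rintro rfl
    exact he.not_indep (hi.subset (by intro x; simp; tauto))
  have hbf : b ≠ f := by
    rintro rfl
    exact hf.not_indep (hi.subset (by intro x; simp; tauto))
  have haE : a ∈ M.E := hi.subset_ground (by simp)
  have hbE : b ∈ M.E := hi.subset_ground (by simp)
  have heE : e ∈ M.E := he.subset_ground (by simp)
  have hfE : f ∈ M.E := hf.subset_ground (by simp)
  let N : Matroid α := (M ／ I) ＼ (M.E \ (I ∪ {a, b, e, f}))
  have hNE : N.E = {a, b, e, f} := by
    ext x
    simp only [N, delete_ground, contract_ground, mem_sdiff, mem_union, mem_insert_iff,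
      mem_singleton_iff]
    constructor
    · tauto
    · rintro (rfl | rfl | rfl | rfl) <;> tauto
  have hNI : ∀ J ⊆ N.E, (N.Indep J ↔ e ∉ J ∧ f ∉ J) := by
    intro J hJ
    rw [hNE] at hJ
    simp only [N, delete_indep_iff, hI.contract_indep_iff]
    constructor
    · rintro ⟨⟨-, h⟩, -⟩
      exact ⟨fun h' ↦ he.not_indep (h.subset (by rintro x (rfl | h) <;> simp_all)),
        fun h' ↦ hf.not_indep (h.subset (by rintro x (rfl | h) <;> simp_all))⟩
    · rintro ⟨h1, h2⟩
      have hJ' : J ⊆ {a, b} := by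
        intro x hx
        have := hJ hx
        simp only [mem_insert_iff, mem_singleton_iff] at this ⊢
        rcases this with rfl | rfl | rfl | rfl <;> tauto
      refine ⟨⟨?_, hi.subset (by rw [union_comm]; exact union_subset_union_right _ hJ')⟩, ?_⟩
      · rw [Set.disjoint_left]
        intro x hx
        rcases hJ' hx with rfl | rfl <;> assumption
      · rw [Set.disjoint_left]
        intro x hx h
        exact h.2 (Or.inr (hJ hx))
  let g : Fin 4 → α := ![a, b, e, f]
  have hg : Function.Injective g := by
    intro i j
    fin_cases i <;> fin_cases j <;> simp [g, hab, hae, haf, hbe, hbf, hef, hab.symm, hae.symm,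
      haf.symm, hbe.symm, hbf.symm, hef.symm]
  have hrange : range g = N.E := by
    rw [hNE]; ext x; simp [g, eq_comm]; tauto
  let φ : N.E ≃ (univ : Set (Fin 4)) :=
    ((Equiv.Set.univ (Fin 4)).trans ((Equiv.ofInjective g hg).trans (Equiv.setCongr hrange))).symm
  have hφ : ∀ i : Fin 4, ((φ.symm ⟨i, mem_univ i⟩ : N.E) : α) = g i := fun i ↦ rfl
  refine fun hU ↦ hU ⟨N, ⟨I, M.E \ (I ∪ {a, b, e, f}), hI.subset_ground, sdiff_subset, ?_, rfl⟩,
    φ, fun J ↦ ?_⟩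
  · rw [Set.disjoint_left]
    exact fun x hx h ↦ h.2 (Or.inl hx)
  rw [hNI _ (by rintro _ ⟨x, -, rfl⟩; exact x.2)]
  have hmem : ∀ i : Fin 4, g i ∈ ((↑) '' J : Set α) ↔ i ∈ ((↑) '' (φ '' J) : Set (Fin 4)) := by
    intro i
    constructor
    · rintro ⟨x, hx, hxi⟩
      refine ⟨φ x, ⟨x, hx, rfl⟩, ?_⟩
      have : x = φ.symm ⟨i, mem_univ i⟩ := Subtype.ext (hxi.trans (hφ i).symm)
      rw [this]; simp
    · rintro ⟨_, ⟨x, hx, rfl⟩, hxi⟩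
      refine ⟨x, hx, ?_⟩
      rw [← hφ i]
      congr 1
      rw [Equiv.eq_symm_apply]
      exact Subtype.ext hxi
  have h2 := hmem 2
  have h3 := hmem 3
  change e ∈ _ ↔ _ at h2
  change f ∈ _ ↔ _ at h3
  rw [h2, h3]
  exact (mem_aux _).trans (freeLoopy_indep _).symm

/-- A minor isomorphic to `U_{2,2} ⊕ U_{0,2}` gives four elements. -/
lemma of_minor {α : Type*} (M : Matroid α) (h : ¬ M.KLUniform 2 2) :
    ∃ (I : Set α) (a b e f : α), a ≠ b ∧ a ∉ I ∧ b ∉ I ∧ M.Indep (I ∪ {a, b}) ∧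
      e ≠ f ∧ e ∉ I ∧ f ∉ I ∧ M.Dep (insert e I) ∧ M.Dep (insert f I) := by
  rw [KLUniform, not_not] at h
  obtain ⟨N, ⟨C, D, hC, hD, hCD, rfl⟩, φ, hφ⟩ := h
  change ((M ／ C) ＼ D).E ≃ _ at φ
  change ∀ J : Set ((M ／ C) ＼ D).E, ((M ／ C) ＼ D).Indep _ ↔ _ at hφ
  let p : Fin 4 → ((M ／ C) ＼ D).E := fun i ↦ φ.symm ⟨i, mem_univ i⟩
  have hp : Function.Injective p := by
    intro i j hij
    exact congrArg Subtype.val (φ.symm.injective hij)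
  have hpv : ∀ i j, i ≠ j → (p i : α) ≠ p j := fun i j hij h ↦ hij (hp (Subtype.ext h))
  obtain ⟨I, hI⟩ := M.exists_isBasis C hC
  have hind : ∀ K : Set (Fin 4), ((M ／ C) ＼ D).Indep ((fun i ↦ (p i : α)) '' K) ↔
      ∀ i ∈ K, (i : ℕ) < 2 := by
    intro K
    have := hφ (p '' K)
    have e1 : (Subtype.val '' (p '' K) : Set α) = (fun i ↦ (p i : α)) '' K := by
      rw [image_image]
    have e2 : (Subtype.val '' (φ '' (p '' K)) : Set (Fin 4)) = K := by
      have e3 : ∀ i, φ (p i) = ⟨i, mem_univ i⟩ := fun i ↦ φ.apply_symm_apply _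
      ext x
      constructor
      · rintro ⟨_, ⟨_, ⟨i, hi, rfl⟩, rfl⟩, rfl⟩
        rw [e3]
        exact hi
      · intro hx
        exact ⟨_, ⟨_, ⟨x, hx, rfl⟩, rfl⟩, congrArg Subtype.val (e3 x)⟩
    rw [← e1]
    refine this.trans ((freeLoopy_indep _).trans ?_)
    have e4 : ∀ L : Set (Fin 4), L = K → ((∀ i ∈ L, (i : ℕ) < 2) ↔ ∀ i ∈ K, (i : ℕ) < 2) := by
      rintro L rfl
      rfl
    exact e4 _ e2
  have hpE : ∀ i, (p i : α) ∈ M.E ∧ (p i : α) ∉ C ∧ (p i : α) ∉ D := fun i ↦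
    ⟨(p i).2.1.1, (p i).2.1.2, (p i).2.2⟩
  have hpI : ∀ i, (p i : α) ∉ I := fun i h ↦ (hpE i).2.1 (hI.subset h)
  have hdep : ∀ i : Fin 4, ¬ (i : ℕ) < 2 → M.Dep (insert (p i : α) I) := by
    intro i hi
    have h1 := (hind {i}).not.2 (by simpa using hi)
    rw [dep_iff, insert_subset_iff]
    refine ⟨fun h ↦ h1 ?_, (hpE i).1, hI.indep.subset_ground⟩
    rw [image_singleton, delete_indep_iff, hI.contract_indep_iff]
    simp [hpE i, h]
  refine ⟨I, p 0, p 1, p 2, p 3, hpv _ _ (by decide), hpI _, hpI _, ?_, hpv _ _ (by decide),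
    hpI _, hpI _, hdep _ (by decide), hdep _ (by decide)⟩
  have h1 := (hind {0, 1}).2 (by simp)
  rw [image_pair, delete_indep_iff, hI.contract_indep_iff] at h1
  rw [union_comm]
  exact h1.1.1

theorem stmt17 {α : Type*} (M : Matroid α) (hfin : M.Finite) :
    M.KLUniform 2 2 ↔ ∀ C₁ C₂, M.CircuitM C₁ → M.CircuitM C₂ → C₁ ≠ C₂ →
      M.rankM - 1 ≤ M.rSet (C₁ ∪ C₂) := by
  constructor
  · intro hU C₁ C₂ hC₁ hC₂ hne
    rw [circuitM_iff] at hC₁ hC₂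
    by_contra hlt
    push Not at hlt
    obtain ⟨e, he⟩ := hC₁.nonempty
    have hXE : C₁ ∪ C₂ ⊆ M.E := union_subset hC₁.subset_ground hC₂.subset_ground
    obtain ⟨I, hI, hCI⟩ := (hC₁.sdiff_singleton_indep he).subset_isBasis_of_subset
      (X := C₁ ∪ C₂) (sdiff_subset.trans subset_union_left) hXE
    have hC₁I : C₁ ⊆ insert e I := by
      intro x hx
      by_cases hxe : x = e
      · exact Or.inl hxe
      · exact Or.inr (hCI ⟨hx, hxe⟩)
    have heI : e ∉ I := fun h ↦ hC₁.not_indep (hI.indep.subset (by rwa [insert_eq_of_mem h] at hC₁I))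
    have hf : ∃ f ∈ C₂, f ∉ insert e I := by
      by_contra! hcon
      exact hne ((hC₁.eq_fundCircuit_of_subset hI.indep hC₁I).trans
        (hC₂.eq_fundCircuit_of_subset hI.indep hcon).symm)
    obtain ⟨f, hfC, hf⟩ := hf
    rw [mem_insert_iff, not_or] at hf
    obtain ⟨B, hB, hIB⟩ := hI.indep.exists_isBase_superset
    have hBfin : B.Finite := M.set_finite B hB.subset_ground
    have hr : M.rankM = B.ncard := by
      have := M.rSet_cast M.E
      rw [← hB.isBasis_ground.encard_eq_eRk, ← hBfin.cast_ncard_eq] at this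
      exact_mod_cast this
    have hrI : M.rSet (C₁ ∪ C₂) = I.ncard := by
      have := M.rSet_cast (C₁ ∪ C₂)
      rw [← hI.encard_eq_eRk, ← (hBfin.subset hIB).cast_ncard_eq] at this
      exact_mod_cast this
    have hcard : 1 < (B \ I).ncard := by
      have := ncard_sdiff_add_ncard_of_subset hIB hBfin
      omega
    obtain ⟨a, ha, b, hb, hab⟩ := (one_lt_ncard (hBfin.subset sdiff_subset)).1 hcard
    refine M.exists_minor hab ha.2 hb.2 (hB.indep.subset ?_) (Ne.symm hf.1) heI hf.2
      (hI.insert_dep ⟨Or.inl he, heI⟩) (hI.insert_dep ⟨Or.inr hfC, hf.2⟩) hU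
    rintro x (hx | rfl | rfl)
    exacts [hIB hx, ha.1, hb.1]
  · intro h
    by_contra hU
    obtain ⟨I, a, b, e, f, hab, haI, hbI, hi, hef, heI, hfI, he, hf⟩ := M.of_minor hU
    have hI : M.Indep I := hi.subset subset_union_left
    have he' := (hI.mem_closure_iff_of_notMem heI).2 he
    have hf' := (hI.mem_closure_iff_of_notMem hfI).2 hf
    have hCe := hI.fundCircuit_isCircuit he' heI
    have hCf := hI.fundCircuit_isCircuit hf' hfI
    have hsub : ∀ x, x ∈ M.closure I → M.fundCircuit x I ⊆ M.closure I := fun x hx ↦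
      (M.fundCircuit_subset_insert x I).trans (insert_subset hx (M.subset_closure I hI.subset_ground))
    have hle := h _ _ ((M.circuitM_iff _).2 hCe) ((M.circuitM_iff _).2 hCf) (by
      intro heq
      have := M.fundCircuit_subset_insert f I (heq ▸ M.mem_fundCircuit e I)
      rcases this with h | h
      exacts [hef h, heI h])
    have hIfin : I.Finite := M.set_finite I hI.subset_ground
    have h1 : M.rSet (M.fundCircuit e I ∪ M.fundCircuit f I) ≤ I.ncard := by
      have := M.eRk_mono (union_subset (hsub e he') (hsub f hf'))
      rw [eRk_closure_eq, hI.eRk_eq_encard, ← hIfin.cast_ncard_eq, ← rSet_cast] at this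
      exact_mod_cast this
    have h2 : I.ncard + 2 ≤ M.rankM := by
      have := hi.encard_le_eRk_of_subset hi.subset_ground
      rw [← (M.set_finite _ hi.subset_ground).cast_ncard_eq, ← rSet_cast,
        ncard_union_eq (by simp [haI, hbI]) hIfin, ncard_pair hab] at this
      exact_mod_cast this
    omega

end Matroid
end
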